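/- Let G be a Garside group with Garside element Δ. For every g ∈ G, len_s(g) − 2 ≤ t_len(g) ≤ len_s(g), where len_s(g) = sup_s(g) − inf_s(g). -/

import Mathlib

open Filter Topology Pointwise

/-- Left divisibility order on a group relative to a submonoid `P` of positive elements:
`a ≤_L b` iff `a⁻¹ * b ∈ P`. -/
def leL {G : Type*} [Group G] (P : Submonoid G) (a b : G) : Prop := a⁻¹ * b ∈ P

/-- Right divisibility order: `a ≤_R b` iff `b * a⁻¹ ∈ P`. -/
def leR {G : Type*} [Group G] (P : Submonoid G) (a b : G) : Prop := b * a⁻¹ ∈ P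

/-- An atom of the positive monoid `P`: a nontrivial element admitting no nontrivial
factorization inside `P`. -/
def IsMonAtom {G : Type*} [Group G] (P : Submonoid G) (a : G) : Prop :=
  a ∈ P ∧ a ≠ 1 ∧ ∀ b c : G, b ∈ P → c ∈ P → a = b * c → b = 1 ∨ c = 1

/-- `a` can be written as a product of `n` atoms of `P`. -/
def IsAtomProd {G : Type*} [Group G] (P : Submonoid G) (n : ℕ) (a : G) : Prop :=
  ∃ l : List G, l.length = n ∧ (∀ x ∈ l, IsMonAtom P x) ∧ l.prod = a

/-- A Garside structure on a group `G`: `G` is the group of fractions of the positive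
monoid `P`, which is a finitely generated atomic monoid (with atomic norm `norm`),
a lattice for both `≤_L` and `≤_R`, equipped with a Garside element `Δ` whose left and
right divisors coincide and generate `P`.  The fields `zinf`, `zsup`, `infs`, `sups`,
`tinf`, `tsup` are the (uniquely determined) invariants
`inf g = max {r : Δ^r ≤_L g}`, `sup g = min {s : g ≤_L Δ^s}`,
`inf_s g = max {inf h : h ∈ [g]}`, `sup_s g = min {sup h : h ∈ [g]}`,
`t_inf g = lim inf(gⁿ)/n` and `t_sup g = lim sup(gⁿ)/n`,
each given together with its defining specification. -/
structure GarsideGroup (G : Type*) [Group G] where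
  P : Submonoid G
  /-- `G` is the group of fractions of `P`. -/
  fraction : ∀ g : G, ∃ a b : G, a ∈ P ∧ b ∈ P ∧ g = a⁻¹ * b
  /-- `P` is finitely generated. -/
  fg : P.FG
  /-- the atomic norm `‖·‖` -/
  norm : G → ℕ
  /-- `P` is atomic: every positive element is a product of atoms and `norm a` is the
  greatest length of such an expression. -/
  norm_spec : ∀ a ∈ P, IsGreatest {n : ℕ | IsAtomProd P n a} (norm a)
  /-- `(P, ≤_L)` is a lattice: gcd's and lcm's exist. -/
  latticeL : ∀ a ∈ P, ∀ b ∈ P,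
    (∃ c ∈ P, leL P c a ∧ leL P c b ∧ ∀ d ∈ P, leL P d a → leL P d b → leL P d c) ∧
    (∃ c ∈ P, leL P a c ∧ leL P b c ∧ ∀ d ∈ P, leL P a d → leL P b d → leL P c d)
  /-- `(P, ≤_R)` is a lattice. -/
  latticeR : ∀ a ∈ P, ∀ b ∈ P,
    (∃ c ∈ P, leR P c a ∧ leR P c b ∧ ∀ d ∈ P, leR P d a → leR P d b → leR P d c) ∧
    (∃ c ∈ P, leR P a c ∧ leR P b c ∧ ∀ d ∈ P, leR P a d → leR P b d → leR P c d)
  /-- the Garside element -/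
  Δ : G
  Δ_mem : Δ ∈ P
  /-- the left and right divisors of `Δ` coincide -/
  Δ_balanced : ∀ a ∈ P, (leL P a Δ ↔ leR P a Δ)
  /-- the simple elements generate `P` -/
  simples_gen : Submonoid.closure {a : G | a ∈ P ∧ leL P a Δ} = P
  /-- `inf g = max {r : ℤ | Δ^r ≤_L g}` -/
  zinf : G → ℤ
  /-- `sup g = min {s : ℤ | g ≤_L Δ^s}` -/
  zsup : G → ℤ
  zinf_spec : ∀ g : G, IsGreatest {r : ℤ | leL P (Δ ^ r) g} (zinf g)
  zsup_spec : ∀ g : G, IsLeast {s : ℤ | leL P g (Δ ^ s)} (zsup g)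
  /-- `inf_s g = max {inf h : h ∈ [g]}` -/
  infs : G → ℤ
  /-- `sup_s g = min {sup h : h ∈ [g]}` -/
  sups : G → ℤ
  infs_spec : ∀ g : G, IsGreatest (Set.range fun h : G => zinf (h⁻¹ * g * h)) (infs g)
  sups_spec : ∀ g : G, IsLeast (Set.range fun h : G => zsup (h⁻¹ * g * h)) (sups g)
  /-- `t_inf g = lim_{n → ∞} inf(gⁿ)/n` -/
  tinf : G → ℝ
  /-- `t_sup g = lim_{n → ∞} sup(gⁿ)/n` -/
  tsup : G → ℝ
  tinf_spec : ∀ g : G,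
    Filter.Tendsto (fun n : ℕ => (zinf (g ^ n) : ℝ) / (n : ℝ)) Filter.atTop (nhds (tinf g))
  tsup_spec : ∀ g : G,
    Filter.Tendsto (fun n : ℕ => (zsup (g ^ n) : ℝ) / (n : ℝ)) Filter.atTop (nhds (tsup g))

namespace GarsideGroup

variable {G : Type*} [Group G] (Γ : GarsideGroup G)

/-- The set `𝒟` of simple elements. -/
def simples : Set G := {a : G | a ∈ Γ.P ∧ leL Γ.P a Γ.Δ}

/-- `len g = sup g - inf g` -/
def len (g : G) : ℤ := Γ.zsup g - Γ.zinf g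

/-- `t_len g = t_sup g - t_inf g` -/
noncomputable def tlen (g : G) : ℝ := Γ.tsup g - Γ.tinf g

/-- `g` is inf-straight if `inf g = t_inf g`. -/
def InfStraight (g : G) : Prop := (Γ.zinf g : ℝ) = Γ.tinf g

/-- `g` is sup-straight if `sup g = t_sup g`. -/
def SupStraight (g : G) : Prop := (Γ.zsup g : ℝ) = Γ.tsup g

/-- The super summit set `[g]^S`. -/
def superSummit (g : G) : Set G :=
  {h : G | (∃ x : G, x⁻¹ * g * x = h) ∧ Γ.zinf h = Γ.infs g ∧ Γ.zsup h = Γ.sups g}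

end GarsideGroup

/-- The shortest length of a word over the alphabet `X` representing `g`. -/
noncomputable def wlen {G : Type*} [Group G] (X : Set G) (g : G) : ℕ :=
  sInf {n : ℕ | ∃ l : List G, l.length = n ∧ (∀ x ∈ l, x ∈ X) ∧ l.prod = g}

namespace GarsideGroup

variable {G : Type*} [Group G] (Γ : GarsideGroup G)

lemma conj_mem {p : G} (hp : p ∈ Γ.P) : Γ.Δ⁻¹ * p * Γ.Δ ∈ Γ.P := by
  rw [← Γ.simples_gen] at hp
  induction hp using Submonoid.closure_induction with
  | mem s hs =>
    obtain ⟨h1, h2⟩ := hs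
    have h3 : s⁻¹ * Γ.Δ ∈ Γ.P := h2
    have h4 : leL Γ.P (s⁻¹ * Γ.Δ) Γ.Δ := by
      rw [Γ.Δ_balanced _ h3]
      simpa [leR] using h1
    simpa [leL, mul_assoc] using h4
  | one => simpa using Γ.P.one_mem
  | mul x y _ _ hx hy => simpa [mul_assoc] using Γ.P.mul_mem hx hy

lemma conj_mem' {p : G} (hp : p ∈ Γ.P) : Γ.Δ * p * Γ.Δ⁻¹ ∈ Γ.P := by
  rw [← Γ.simples_gen] at hp
  induction hp using Submonoid.closure_induction with
  | mem s hs =>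
    obtain ⟨h1, h2⟩ := hs
    have h3 : Γ.Δ * s⁻¹ ∈ Γ.P := (Γ.Δ_balanced _ h1).1 h2
    have h4 : leR Γ.P (Γ.Δ * s⁻¹) Γ.Δ := by
      rw [← Γ.Δ_balanced _ h3]
      simpa [leL] using h1
    simpa [leR, mul_assoc] using h4
  | one => simpa using Γ.P.one_mem
  | mul x y _ _ hx hy => simpa [mul_assoc] using Γ.P.mul_mem hx hy

lemma conj_zpow_mem (z : ℤ) {p : G} (hp : p ∈ Γ.P) : (Γ.Δ ^ z)⁻¹ * p * Γ.Δ ^ z ∈ Γ.P := by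
  induction z using Int.induction_on with
  | zero => simpa using hp
  | succ i ih =>
    have := Γ.conj_mem ih
    rw [zpow_add_one]
    simpa only [mul_assoc, mul_inv_rev] using this
  | pred i ih =>
    have := Γ.conj_mem' ih
    rw [zpow_sub_one]
    simpa only [mul_assoc, mul_inv_rev, inv_inv] using this

/-- the twisted translation `x ↦ a x Δ^z` is an order automorphism -/
lemma le_map (a : G) (z : ℤ) {x y : G} (h : leL Γ.P x y) :
    leL Γ.P (a * x * Γ.Δ ^ z) (a * y * Γ.Δ ^ z) := by
  have := Γ.conj_zpow_mem z h
  have e : (a * x * Γ.Δ ^ z)⁻¹ * (a * y * Γ.Δ ^ z) = (Γ.Δ ^ z)⁻¹ * (x⁻¹ * y) * Γ.Δ ^ z := by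
    group
  unfold leL
  rw [e]
  exact this

lemma le_trans' {x y w : G} (h : leL Γ.P x y) (h' : leL Γ.P y w) : leL Γ.P x w := by
  have := Γ.P.mul_mem h h'
  simpa [leL, mul_assoc] using this

lemma le_left (a : G) {x y : G} (h : leL Γ.P x y) : leL Γ.P (a * x) (a * y) := by
  simpa using Γ.le_map a 0 h

lemma le_right (z : ℤ) {x y : G} (h : leL Γ.P x y) :
    leL Γ.P (x * Γ.Δ ^ z) (y * Γ.Δ ^ z) := by
  simpa using Γ.le_map 1 z h

lemma zpow_mono {m n : ℤ} (h : m ≤ n) : leL Γ.P (Γ.Δ ^ m) (Γ.Δ ^ n) := by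
  obtain ⟨k, rfl⟩ := Int.le.dest h
  unfold leL
  rw [zpow_add, inv_mul_cancel_left, zpow_natCast]
  exact Γ.P.pow_mem Γ.Δ_mem k

lemma exists_join (a b : G) : ∃ c, leL Γ.P a c ∧ leL Γ.P b c ∧
    ∀ d, leL Γ.P a d → leL Γ.P b d → leL Γ.P c d := by
  obtain ⟨m, ha, hb⟩ : ∃ m : ℤ, leL Γ.P (Γ.Δ ^ m) a ∧ leL Γ.P (Γ.Δ ^ m) b :=
    ⟨min (Γ.zinf a) (Γ.zinf b),
      Γ.le_trans' (Γ.zpow_mono (min_le_left _ _)) (Γ.zinf_spec a).1,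
      Γ.le_trans' (Γ.zpow_mono (min_le_right _ _)) (Γ.zinf_spec b).1⟩
  obtain ⟨c, hc, h1, h2, h3⟩ := (Γ.latticeL _ ha _ hb).2
  have key : ∀ {x y : G}, leL Γ.P ((Γ.Δ ^ m)⁻¹ * x) y → leL Γ.P x (Γ.Δ ^ m * y) := by
    intro x y h
    simpa using Γ.le_left (Γ.Δ ^ m) h
  refine ⟨Γ.Δ ^ m * c, key h1, key h2, fun d hd1 hd2 => ?_⟩
  have := h3 ((Γ.Δ ^ m)⁻¹ * d) (Γ.le_trans' ha hd1) (Γ.le_left _ hd1) (Γ.le_left _ hd2)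
  simpa using Γ.le_left (Γ.Δ ^ m) this

lemma exists_finite_join (f : ℕ → G) (n : ℕ) : ∃ c, (∀ k ≤ n, leL Γ.P (f k) c) ∧
    ∀ d, (∀ k ≤ n, leL Γ.P (f k) d) → leL Γ.P c d := by
  induction n with
  | zero =>
    refine ⟨f 0, fun k hk => ?_, fun d hd => hd 0 le_rfl⟩
    obtain rfl : k = 0 := by omega
    simpa [leL] using Γ.P.one_mem
  | succ n ih =>
    obtain ⟨c, h1, h2⟩ := ih
    obtain ⟨e, h3, h4, h5⟩ := Γ.exists_join c (f (n + 1))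
    refine ⟨e, fun k hk => ?_, fun d hd => h5 d (h2 d fun k hk => hd k (by omega)) (hd _ le_rfl)⟩
    rcases Nat.lt_or_ge n k with h | h
    · obtain rfl : k = n + 1 := by omega
      exact h4
    · exact Γ.le_trans' (h1 k h) h3

/-- iterates of `x ↦ g x Δ^z` -/
def tw (g : G) (z : ℤ) (n : ℕ) (x : G) : G := g ^ n * x * Γ.Δ ^ (n * z)

lemma tw_zero (g : G) (z : ℤ) (x : G) : Γ.tw g z 0 x = x := by simp [tw]

lemma tw_one (g : G) (z : ℤ) (x : G) : Γ.tw g z 1 x = g * x * Γ.Δ ^ z := by simp [tw]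

lemma tw_tw (g : G) (z : ℤ) (m n : ℕ) (x : G) :
    Γ.tw g z m (Γ.tw g z n x) = Γ.tw g z (m + n) x := by
  simp only [tw, pow_add, Nat.cast_add, add_mul, mul_assoc, ← zpow_add]
  rw [add_comm]

lemma tw_mono (g : G) (z : ℤ) (n : ℕ) {x y : G} (h : leL Γ.P x y) :
    leL Γ.P (Γ.tw g z n x) (Γ.tw g z n y) := Γ.le_map _ _ h

lemma tw_inv (g : G) (z : ℤ) (y : G) : ∃ x, Γ.tw g z 1 x = y :=
  ⟨g⁻¹ * y * (Γ.Δ ^ z)⁻¹, by simp [tw_one, mul_assoc]⟩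

lemma le_of_tw_le (g : G) (z : ℤ) {x y : G} (h : leL Γ.P (Γ.tw g z 1 x) (Γ.tw g z 1 y)) :
    leL Γ.P x y := by
  have := Γ.le_map g⁻¹ (-z) h
  simpa [tw_one, mul_assoc] using this

lemma refl' (x : G) : leL Γ.P x x := by simpa [leL] using Γ.P.one_mem

lemma le_iter (g : G) (z : ℤ) {x : G} (h : leL Γ.P x (Γ.tw g z 1 x)) (n : ℕ) :
    leL Γ.P x (Γ.tw g z n x) := by
  induction n with
  | zero => rw [tw_zero]; exact Γ.refl' x
  | succ n ih =>
    rw [← tw_tw]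
    exact Γ.le_trans' ih (Γ.tw_mono g z n h)

lemma iter_le (g : G) (z : ℤ) {x : G} (h : leL Γ.P (Γ.tw g z 1 x) x) (n : ℕ) :
    leL Γ.P (Γ.tw g z n x) x := by
  induction n with
  | zero => rw [tw_zero]; exact Γ.refl' x
  | succ n ih =>
    rw [← tw_tw]
    exact Γ.le_trans' (Γ.tw_mono g z n h) ih

lemma exists_le_tw (g : G) (z : ℤ) (n : ℕ) (h : leL Γ.P 1 (Γ.tw g z (n + 1) 1)) :
    ∃ x, leL Γ.P x (Γ.tw g z 1 x) := by
  obtain ⟨c, h1, h2⟩ := Γ.exists_finite_join (fun k => Γ.tw g z k 1) n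
  have h3 : ∀ k ≤ n, leL Γ.P (Γ.tw g z (k + 1) 1) (Γ.tw g z 1 c) := fun k hk => by
    rw [add_comm, ← tw_tw]
    exact Γ.tw_mono _ _ _ (h1 k hk)
  refine ⟨c, h2 _ fun k hk => ?_⟩
  cases k with
  | zero =>
    simp only [tw_zero]
    exact Γ.le_trans' h (h3 n le_rfl)
  | succ k => exact h3 k (by omega)

lemma exists_tw_le (g : G) (z : ℤ) (n : ℕ) (h : leL Γ.P (Γ.tw g z (n + 1) 1) 1) :
    ∃ x, leL Γ.P (Γ.tw g z 1 x) x := by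
  obtain ⟨c, h1, h2⟩ := Γ.exists_finite_join (fun k => Γ.tw g z k 1) n
  refine ⟨c, ?_⟩
  obtain ⟨d, hd⟩ := Γ.tw_inv g z c
  nth_rw 2 [← hd]
  refine Γ.tw_mono _ _ _ (h2 d fun k hk => Γ.le_of_tw_le g z ?_)
  rw [tw_tw, hd, add_comm]
  rcases Nat.lt_or_ge k n with h' | h'
  · exact h1 (k + 1) h'
  · obtain rfl : k = n := by omega
    have := h1 0 (by omega)
    simp only [tw_zero] at this
    exact Γ.le_trans' h this

lemma le_zinf_iff (r : ℤ) (g : G) : r ≤ Γ.zinf g ↔ leL Γ.P (Γ.Δ ^ r) g :=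
  ⟨fun h => Γ.le_trans' (Γ.zpow_mono h) (Γ.zinf_spec g).1, fun h => (Γ.zinf_spec g).2 h⟩

lemma zsup_le_iff (r : ℤ) (g : G) : Γ.zsup g ≤ r ↔ leL Γ.P g (Γ.Δ ^ r) :=
  ⟨fun h => Γ.le_trans' (Γ.zsup_spec g).1 (Γ.zpow_mono h), fun h => (Γ.zsup_spec g).2 h⟩

lemma le_zinf_conj (r : ℤ) (g x : G) :
    r ≤ Γ.zinf (x⁻¹ * g * x) ↔ leL Γ.P x (Γ.tw g (-r) 1 x) := by
  rw [le_zinf_iff, tw_one]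
  constructor
  · intro h
    simpa [mul_assoc] using Γ.le_map x (-r) h
  · intro h
    simpa [mul_assoc] using Γ.le_map x⁻¹ r h

lemma zsup_conj_le (r : ℤ) (g x : G) :
    Γ.zsup (x⁻¹ * g * x) ≤ r ↔ leL Γ.P (Γ.tw g (-r) 1 x) x := by
  rw [zsup_le_iff, tw_one]
  constructor
  · intro h
    simpa [mul_assoc] using Γ.le_map x (-r) h
  · intro h
    simpa [mul_assoc] using Γ.le_map x⁻¹ r h

lemma le_tw_pow (r : ℤ) (g : G) (n : ℕ) :
    n * r ≤ Γ.zinf (g ^ n) ↔ leL Γ.P 1 (Γ.tw g (-r) n 1) := by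
  have := Γ.le_zinf_conj (n * r) (g ^ n) 1
  simpa [tw] using this

lemma tw_pow_le (r : ℤ) (g : G) (n : ℕ) :
    Γ.zsup (g ^ n) ≤ n * r ↔ leL Γ.P (Γ.tw g (-r) n 1) 1 := by
  have := Γ.zsup_conj_le (n * r) (g ^ n) 1
  simpa [tw] using this

lemma zinf_pow_upper (g : G) (n : ℕ) :
    Γ.zinf (g ^ (n + 1)) ≤ ((n + 1 : ℕ) : ℤ) * (Γ.infs g + 1) := by
  by_contra! h
  obtain ⟨x, hx⟩ := Γ.exists_le_tw g _ n ((Γ.le_tw_pow _ g (n + 1)).1 h.le)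
  have h1 := (Γ.le_zinf_conj _ g x).2 hx
  have h2 := (Γ.infs_spec g).2 ⟨x, rfl⟩
  simp only at h2
  omega

lemma zsup_pow_lower (g : G) (n : ℕ) :
    ((n + 1 : ℕ) : ℤ) * (Γ.sups g - 1) ≤ Γ.zsup (g ^ (n + 1)) := by
  by_contra! h
  obtain ⟨x, hx⟩ := Γ.exists_tw_le g _ n ((Γ.tw_pow_le _ g (n + 1)).1 h.le)
  have h1 := (Γ.zsup_conj_le _ g x).2 hx
  have h2 := (Γ.sups_spec g).2 ⟨x, rfl⟩
  simp only at h2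
  omega

lemma zinf_pow_lower (g : G) : ∃ C : ℤ, ∀ n : ℕ, n * Γ.infs g - C ≤ Γ.zinf (g ^ n) := by
  obtain ⟨x, hx⟩ := (Γ.infs_spec g).1
  have h := Γ.le_iter _ _ ((Γ.le_zinf_conj _ g x).1 hx.ge)
  refine ⟨Γ.zsup x - Γ.zinf x, fun n => ?_⟩
  have h1 := Γ.le_trans' (Γ.le_trans' (Γ.zinf_spec x).1 (h n))
    (Γ.tw_mono g _ n (Γ.zsup_spec x).1)
  have h2 := Γ.le_right (n * Γ.infs g - Γ.zsup x) h1
  rw [le_zinf_iff]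
  simp only [tw, mul_assoc, ← zpow_add] at h2
  convert h2 using 2
  · ring
  · rw [eq_comm, mul_eq_left]
    convert zpow_zero _ using 2
    ring

lemma zsup_pow_upper (g : G) : ∃ C : ℤ, ∀ n : ℕ, Γ.zsup (g ^ n) ≤ n * Γ.sups g + C := by
  obtain ⟨x, hx⟩ := (Γ.sups_spec g).1
  have h := Γ.iter_le _ _ ((Γ.zsup_conj_le _ g x).1 hx.le)
  refine ⟨Γ.zsup x - Γ.zinf x, fun n => ?_⟩
  have h1 := Γ.le_trans' (Γ.tw_mono g _ n (Γ.zinf_spec x).1)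
    (Γ.le_trans' (h n) (Γ.zsup_spec x).1)
  have h2 := Γ.le_right (n * Γ.sups g - Γ.zinf x) h1
  rw [zsup_le_iff]
  simp only [tw, mul_assoc, ← zpow_add] at h2
  convert h2 using 2
  · rw [eq_comm, mul_eq_left]
    convert zpow_zero _ using 2
    ring
  · ring

lemma lim_le {u : ℕ → ℤ} {t : ℝ} (h : Tendsto (fun n : ℕ => (u n : ℝ) / (n : ℝ)) atTop (𝓝 t))
    (a C : ℤ) (hu : ∀ n : ℕ, u (n + 1) ≤ ((n + 1 : ℕ) : ℤ) * a + C) : t ≤ a := by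
  have h2 : Tendsto (fun n : ℕ => (a : ℝ) + (C : ℝ) / (n : ℝ)) atTop (𝓝 (a + 0)) :=
    tendsto_const_nhds.add (tendsto_const_div_atTop_nhds_zero_nat _)
  rw [add_zero] at h2
  refine le_of_tendsto_of_tendsto h h2 ?_
  filter_upwards [eventually_gt_atTop 0] with n hn
  obtain ⟨m, rfl⟩ : ∃ m, n = m + 1 := ⟨n - 1, by omega⟩
  have h3 : (u (m + 1) : ℝ) ≤ ((m + 1 : ℕ) : ℝ) * a + C := by exact_mod_cast hu m
  have h4 : (0 : ℝ) < ((m + 1 : ℕ) : ℝ) := by positivity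
  rw [div_le_iff₀ h4]
  have : ((a : ℝ) + C / ((m + 1 : ℕ) : ℝ)) * ((m + 1 : ℕ) : ℝ) = ((m + 1 : ℕ) : ℝ) * a + C := by
    field_simp
  linarith

lemma le_lim {u : ℕ → ℤ} {t : ℝ} (h : Tendsto (fun n : ℕ => (u n : ℝ) / (n : ℝ)) atTop (𝓝 t))
    (a C : ℤ) (hu : ∀ n : ℕ, ((n + 1 : ℕ) : ℤ) * a - C ≤ u (n + 1)) : (a : ℝ) ≤ t := by
  have h1 : Tendsto (fun n : ℕ => ((-u n : ℤ) : ℝ) / (n : ℝ)) atTop (𝓝 (-t)) := by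
    simpa [neg_div] using h.neg
  have h2 := lim_le (u := fun n => -u n) h1 (-a) C (fun n => by linarith [hu n])
  push_cast at h2
  linarith

end GarsideGroup

/-- `len_s(g) - 2 ≤ t_len(g) ≤ len_s(g)` where
`len_s(g) = sup_s(g) - inf_s(g)`. -/
theorem statement16 {G : Type*} [Group G] (Γ : GarsideGroup G) (g : G) :
    ((Γ.sups g : ℝ) - (Γ.infs g : ℝ)) - 2 ≤ Γ.tlen g ∧
      Γ.tlen g ≤ (Γ.sups g : ℝ) - (Γ.infs g : ℝ) := by
  have h1 := GarsideGroup.lim_le (Γ.tinf_spec g) (Γ.infs g + 1) 0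
    (fun n => by simpa using Γ.zinf_pow_upper g n)
  have h2 := GarsideGroup.le_lim (Γ.tsup_spec g) (Γ.sups g - 1) 0
    (fun n => by simpa using Γ.zsup_pow_lower g n)
  obtain ⟨C, hC⟩ := Γ.zinf_pow_lower g
  obtain ⟨D, hD⟩ := Γ.zsup_pow_upper g
  have h3 := GarsideGroup.le_lim (Γ.tinf_spec g) _ C (fun n => hC (n + 1))
  have h4 := GarsideGroup.lim_le (Γ.tsup_spec g) _ D (fun n => hD (n + 1))
  push_cast at h1 h2
  unfold GarsideGroup.tlen
  constructor <;> linarith
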